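/- arXiv:2403.07056 — 2 statements merged into one kernel-verified Lean document; each statement's English description precedes it below -/
import Mathlib

section
/- Let ρ be a density matrix on ℂ^N (a positive semidefinite complex N×N matrix with trace 1). Then the infimum, over all flat density matrices σ (i.e. σ satisfying σ² = σ / rank(σ), equivalently σ = P/k for an orthogonal projection P of rank k), of the quantum relative entropy S(ρ‖σ) equals log(rank ρ) − S(ρ), and this infimum is attained (namely by σ equal to 1/rank(ρ) times the orthogonal projection onto the support of ρ). -/
open scoped BigOperators ComplexOrder

/-- Matrix logarithm of a Hermitian matrix via functional calculus on its support:
the function `log` is applied to nonzero eigenvalues and `0` to zero eigenvalues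
(junk value `0` for non-Hermitian input). -/
noncomputable def mlog {n : Type*} [Fintype n] [DecidableEq n] (A : Matrix n n ℂ) :
    Matrix n n ℂ :=
  if h : A.IsHermitian then h.cfc (fun x => if x = 0 then 0 else Real.log x) else 0

/-- The eigenvalues of a Hermitian matrix (junk value `0` for non-Hermitian input). -/
noncomputable def eigs {n : Type*} [Fintype n] [DecidableEq n] (A : Matrix n n ℂ) : n → ℝ :=
  if h : A.IsHermitian then h.eigenvalues else 0

/-- The von Neumann entropy `S(ρ) = −Tr[ρ log ρ] = −Σ_k μ_k log μ_k` over the eigenvalues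
`μ_k` of `ρ`, with the convention `0·log 0 = 0`; natural logarithms. -/
noncomputable def vnEntropy {n : Type*} [Fintype n] [DecidableEq n]
    (A : Matrix n n ℂ) : ℝ :=
  ∑ i, Real.negMulLog (eigs A i)

open Classical in
/-- The quantum relative entropy `S(ρ‖σ) = Tr[ρ log ρ] − Tr[ρ log σ]` (functional calculus
taken on the support of `σ`) when the support of `ρ` is contained in the support of `σ`
(equivalently, `ker σ ⊆ ker ρ` for positive semidefinite matrices), and `+∞` otherwise. -/
noncomputable def qRelEntropy {n : Type*} [Fintype n] [DecidableEq n]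
    (ρ σ : Matrix n n ℂ) : EReal :=
  if ∀ v, σ.mulVec v = 0 → ρ.mulVec v = 0 then
    (((ρ * mlog ρ).trace.re - (ρ * mlog σ).trace.re : ℝ) : EReal)
  else ⊤

namespace Matrix.IsHermitian

variable {n : Type*} [Fintype n] [DecidableEq n] {A : Matrix n n ℂ}

lemma cfc_mul_cfc (hA : A.IsHermitian) (f g : ℝ → ℝ) :
    hA.cfc f * hA.cfc g = hA.cfc (fun x => f x * g x) := by
  simp only [Matrix.IsHermitian.cfc, ← map_mul, Matrix.diagonal_mul_diagonal]
  congr 2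
  ext i
  simp

lemma cfc_congr_eigenvalues (hA : A.IsHermitian) {f g : ℝ → ℝ}
    (h : ∀ i, f (hA.eigenvalues i) = g (hA.eigenvalues i)) : hA.cfc f = hA.cfc g := by
  simp only [Matrix.IsHermitian.cfc]
  congr 2
  ext i
  simp [h i]

lemma cfc_id' (hA : A.IsHermitian) : hA.cfc (fun x => x) = A :=
  hA.spectral_theorem.symm

lemma cfc_const_mul_id (hA : A.IsHermitian) (c : ℝ) :
    hA.cfc (fun x => c * x) = (c : ℂ) • A := by
  conv_rhs => rw [← hA.cfc_id']
  simp only [Matrix.IsHermitian.cfc, ← map_smul]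
  congr 1
  ext i j
  by_cases h : i = j <;> simp [h]

lemma trace_cfc (hA : A.IsHermitian) (f : ℝ → ℝ) :
    (hA.cfc f).trace = ((∑ i, f (hA.eigenvalues i) : ℝ) : ℂ) := by
  rw [Matrix.IsHermitian.cfc, Unitary.conjStarAlgAut_apply, Matrix.trace_mul_cycle]
  simp [Matrix.trace_diagonal]

lemma posSemidef_cfc (hA : A.IsHermitian) {f : ℝ → ℝ} (hf : ∀ x, 0 ≤ f x) :
    (hA.cfc f).PosSemidef := by
  rw [Matrix.IsHermitian.cfc, Unitary.conjStarAlgAut_apply, Matrix.star_eq_conjTranspose]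
  refine Matrix.PosSemidef.mul_mul_conjTranspose_same (Matrix.PosSemidef.diagonal fun i => ?_) _
  simpa using hf _

/-- The eigenvalues of a Hermitian matrix with `A ^ 2 = c A` satisfy `x ^ 2 = c x`. -/
lemma eigenvalues_mul_self (hA : A.IsHermitian) {c : ℝ} (h : A * A = (c : ℂ) • A) (i : n) :
    hA.eigenvalues i * hA.eigenvalues i = c * hA.eigenvalues i := by
  rw [← hA.cfc_const_mul_id] at h
  nth_rewrite 1 2 [← hA.cfc_id'] at h
  rw [cfc_mul_cfc] at h
  have h' := Matrix.diagonal_injective (EquivLike.injective _ h)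
  have := congrFun h' i
  simp only [Function.comp_apply] at this
  exact_mod_cast this

end Matrix.IsHermitian

section RelEntropy

variable {n : Type*} [Fintype n] [DecidableEq n] {ρ σ : Matrix n n ℂ}

lemma mlog_eq_cfc_log (hσ : σ.IsHermitian) : mlog σ = hσ.cfc Real.log := by
  rw [mlog, dif_pos hσ]
  refine hσ.cfc_congr_eigenvalues fun i => ?_
  split_ifs with h <;> simp [h]

lemma trace_mul_mlog_self (hρ : ρ.IsHermitian) :
    (ρ * mlog ρ).trace.re = -vnEntropy ρ := by
  rw [mlog_eq_cfc_log hρ]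
  nth_rewrite 1 [← hρ.cfc_id']
  rw [hρ.cfc_mul_cfc, hρ.trace_cfc, Complex.ofReal_re, vnEntropy, eigs, dif_pos hρ]
  simp [Real.negMulLog]

lemma mlog_of_flat (hσ : σ.IsHermitian) {k : ℕ} (hk : k ≠ 0) (h : σ * σ = (k : ℂ)⁻¹ • σ) :
    mlog σ = ((-(k * Real.log k) : ℝ) : ℂ) • σ := by
  rw [mlog_eq_cfc_log hσ, ← hσ.cfc_const_mul_id]
  refine hσ.cfc_congr_eigenvalues fun i => ?_
  have hi := hσ.eigenvalues_mul_self (c := (k : ℝ)⁻¹) (by simpa using h) i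
  by_cases h0 : hσ.eigenvalues i = 0
  · simp [h0]
  · rw [mul_right_cancel₀ h0 hi, Real.log_inv]
    have : (k : ℝ) ≠ 0 := Nat.cast_ne_zero.mpr hk
    field_simp

lemma mul_smul_flat_eq_self {k : ℕ} (hk : k ≠ 0) (h : σ * σ = (k : ℂ)⁻¹ • σ)
    (hsupp : ∀ v, σ.mulVec v = 0 → ρ.mulVec v = 0) : ρ * ((k : ℂ) • σ) = ρ := by
  have hk' : (k : ℂ) ≠ 0 := Nat.cast_ne_zero.mpr hk
  have h0 : σ * (1 - (k : ℂ) • σ) = 0 := by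
    rw [mul_sub, mul_one, Matrix.mul_smul, h, smul_smul, mul_inv_cancel₀ hk', one_smul, sub_self]
  have h1 : ρ * (1 - (k : ℂ) • σ) = 0 := by
    refine Matrix.toLin'.injective (LinearMap.ext fun v => ?_)
    have h2 := hsupp ((1 - (k : ℂ) • σ).mulVec v) (by rw [Matrix.mulVec_mulVec, h0]; simp)
    rw [Matrix.mulVec_mulVec] at h2
    rw [Matrix.toLin'_apply, h2, map_zero, LinearMap.zero_apply]
  rw [mul_sub, mul_one, sub_eq_zero] at h1
  exact h1.symm

/-- The relative entropy to a flat state depends only on its rank once supports are nested. -/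
lemma qRelEntropy_flat (hρ : ρ.IsHermitian) (hρtr : ρ.trace = 1) (hσ : σ.IsHermitian)
    {k : ℕ} (hk : k ≠ 0) (h : σ * σ = (k : ℂ)⁻¹ • σ)
    (hsupp : ∀ v, σ.mulVec v = 0 → ρ.mulVec v = 0) :
    qRelEntropy ρ σ = ((Real.log k - vnEntropy ρ : ℝ) : EReal) := by
  have htr := congrArg Matrix.trace (mul_smul_flat_eq_self hk h hsupp)
  rw [Matrix.mul_smul, Matrix.trace_smul, hρtr, smul_eq_mul] at htr
  have hlog : (ρ * mlog σ).trace = ((-Real.log k : ℝ) : ℂ) := by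
    rw [mlog_of_flat hσ hk h, Matrix.mul_smul, Matrix.trace_smul, smul_eq_mul]
    rw [Complex.ofReal_neg, Complex.ofReal_mul, Complex.ofReal_natCast, Complex.ofReal_neg]
    linear_combination (-(Real.log k : ℂ)) * htr
  rw [qRelEntropy, if_pos hsupp, trace_mul_mlog_self hρ, hlog, Complex.ofReal_re]
  congr 1
  ring

lemma rank_ne_zero_of_trace_eq_one (h : σ.trace = 1) : σ.rank ≠ 0 := by
  intro h0
  rw [Matrix.rank, Submodule.finrank_eq_zero, LinearMap.range_eq_bot] at h0
  have h1 : σ = 0 := Matrix.toLin'.injective (by rw [map_zero]; exact h0)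
  simp [h1] at h

/-- The maximally mixed state on the support of `ρ`. -/
lemma exists_flat_of_support (hρ : ρ.IsHermitian) (hr : ρ.rank ≠ 0) :
    ∃ σ : Matrix n n ℂ, σ.PosSemidef ∧ σ.trace = 1 ∧ σ.rank = ρ.rank ∧
      σ * σ = (ρ.rank : ℂ)⁻¹ • σ ∧ ∀ v, σ.mulVec v = 0 → ρ.mulVec v = 0 := by
  have hr' : (ρ.rank : ℝ) ≠ 0 := Nat.cast_ne_zero.mpr hr
  set g : ℝ → ℝ := fun x => if x = 0 then 0 else (ρ.rank : ℝ)⁻¹ with hg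
  have hfac : ρ * hρ.cfc (fun x => x⁻¹ * (ρ.rank : ℝ)⁻¹) = hρ.cfc g := by
    nth_rewrite 1 [← hρ.cfc_id']
    rw [hρ.cfc_mul_cfc]
    refine hρ.cfc_congr_eigenvalues fun i => ?_
    by_cases h : hρ.eigenvalues i = 0 <;> simp [hg, h]
  have hfac' : hρ.cfc (fun x => ρ.rank * x) * hρ.cfc g = ρ := by
    conv_rhs => rw [← hρ.cfc_id']
    rw [hρ.cfc_mul_cfc]
    refine hρ.cfc_congr_eigenvalues fun i => ?_
    by_cases h : hρ.eigenvalues i = 0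
    · simp [hg, h]
    · simp only [hg, h, if_false]
      field_simp
  refine ⟨hρ.cfc g, hρ.posSemidef_cfc fun x => ?_, ?_, le_antisymm ?_ ?_, ?_, fun v hv => ?_⟩
  · simp only [hg]
    split_ifs <;> positivity
  · rw [hρ.trace_cfc]
    have hsum : ∑ i, g (hρ.eigenvalues i) = 1 := by
      simp only [hg]
      rw [← Finset.sum_filter_not_add_sum_filter Finset.univ (fun i => hρ.eigenvalues i = 0),
        Finset.sum_congr rfl (g := fun _ => (ρ.rank : ℝ)⁻¹)
          (fun i hi => if_neg (Finset.mem_filter.mp hi).2),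
        Finset.sum_eq_zero (fun i hi => if_pos (Finset.mem_filter.mp hi).2), add_zero,
        Finset.sum_const, nsmul_eq_mul, ← Fintype.card_subtype, ← hρ.rank_eq_card_non_zero_eigs,
        mul_inv_cancel₀ hr']
    rw [hsum, Complex.ofReal_one]
  · rw [← hfac]
    exact Matrix.rank_mul_le_left _ _
  · conv_lhs => rw [← hfac']
    exact Matrix.rank_mul_le_right _ _
  · have hscal : hρ.cfc (fun _ => (ρ.rank : ℝ)⁻¹) = (ρ.rank : ℂ)⁻¹ • (1 : Matrix n n ℂ) := by
      rw [Matrix.IsHermitian.cfc, ← map_one (Unitary.conjStarAlgAut ℂ _ hρ.eigenvectorUnitary),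
        ← map_smul]
      congr 1
      ext i j
      by_cases h : i = j <;> simp [h]
    rw [← one_mul (hρ.cfc g), ← smul_mul_assoc, ← hscal, one_mul, hρ.cfc_mul_cfc, hρ.cfc_mul_cfc]
    refine hρ.cfc_congr_eigenvalues fun i => ?_
    by_cases h : hρ.eigenvalues i = 0 <;> simp [hg, h]
  · rw [← hfac', ← Matrix.mulVec_mulVec, hv, Matrix.mulVec_zero]

end RelEntropy

/-- Let `ρ` be a density matrix on `ℂ^N`. Then the infimum, over all flat
density matrices `σ` (i.e. `σ² = σ / rank σ`), of the quantum relative entropy `S(ρ‖σ)`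
equals `log(rank ρ) − S(ρ)`, and this infimum is attained. -/
theorem isLeast_qRelEntropy_flat {N : ℕ} (ρ : Matrix (Fin N) (Fin N) ℂ)
    (hρ : ρ.PosSemidef) (hρtr : ρ.trace = 1) :
    IsLeast
      {x : EReal | ∃ σ : Matrix (Fin N) (Fin N) ℂ, σ.PosSemidef ∧ σ.trace = 1 ∧
        σ * σ = ((σ.rank : ℂ))⁻¹ • σ ∧ x = qRelEntropy ρ σ}
      ((Real.log ρ.rank - vnEntropy ρ : ℝ) : EReal) := by
  constructor
  · obtain ⟨σ, hσ, hσtr, hrank, hflat, hsupp⟩ :=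
      exists_flat_of_support hρ.isHermitian (rank_ne_zero_of_trace_eq_one hρtr)
    exact ⟨σ, hσ, hσtr, by rw [hrank, hflat], (qRelEntropy_flat hρ.isHermitian hρtr
      hσ.isHermitian (rank_ne_zero_of_trace_eq_one hρtr) hflat hsupp).symm⟩
  · rintro x ⟨σ, hσ, hσtr, hflat, rfl⟩
    have hk := rank_ne_zero_of_trace_eq_one hσtr
    by_cases hsupp : ∀ v, σ.mulVec v = 0 → ρ.mulVec v = 0
    · rw [qRelEntropy_flat hρ.isHermitian hρtr hσ.isHermitian hk hflat hsupp,
        EReal.coe_le_coe_iff]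
      have hle : ρ.rank ≤ σ.rank := by
        have heq := mul_smul_flat_eq_self hk hflat hsupp
        rw [Matrix.mul_smul, ← Matrix.smul_mul] at heq
        conv_lhs => rw [← heq]
        exact Matrix.rank_mul_le_right _ _
      have hpos : (0 : ℝ) < ρ.rank :=
        Nat.cast_pos.mpr (Nat.pos_of_ne_zero (rank_ne_zero_of_trace_eq_one hρtr))
      exact sub_le_sub_right (Real.log_le_log hpos (Nat.cast_le.mpr hle)) _
    · rw [qRelEntropy, if_neg hsupp]
      exact le_top
end

section
/- Let n ≥ 2 and d ≥ 2, and consider (ℂ^d)^{⊗n} bipartitioned into the first k qudits (A) and the remaining n−k qudits (B), 1 ≤ k < n. Let ψ_AB be a pure-state density matrix, ψ_A its partial trace over B, S(A) = −Tr[ψ_A log ψ_A] its von Neumann entropy and S_max(A) = log rank(ψ_A) its max entropy. Define the relative stabilizer entropy of magic M_RS(ρ) = min_{σ ∈ STAB₀^{(n)}} S(ρ‖σ) and the non-local relative stabilizer entropy M_RS^{(NL)}(ψ_AB) as the infimum of M_RS((U_A⊗U_B)ψ_AB(U_A⊗U_B)ᴴ) over unitaries U_A ⊗ U_B. Then the chain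 of inequalities holds: S_max(A) − S(A) ≤ inf_{U_A} M_RS(U_A ψ_A U_Aᴴ ⊗-extended appropriately on A alone) ≤ M_RS^{(NL)}(ψ_AB) ≤ (log d)·⌈ S_max(A)/log d ⌉, where ⌈·⌉ is the ceiling function and the first infimum is over unitaries U_A acting on subsystem A with M_RS taken over STAB₀^{(k)}. -/
open Matrix Kronecker
open scoped BigOperators ComplexOrder

/-- The qudit shift operator `X|i⟩ = |i+1 mod d⟩`. -/
noncomputable def shiftX (d : ℕ) : Matrix (Fin d) (Fin d) ℂ :=
  Matrix.of fun i j => if (i : ℕ) = ((j : ℕ) + 1) % d then 1 else 0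

/-- The qudit clock operator `Z|j⟩ = ω^j|j⟩`, `ω = exp(2πi/d)`. -/
noncomputable def clockZ (d : ℕ) : Matrix (Fin d) (Fin d) ℂ :=
  Matrix.diagonal fun j => Complex.exp (2 * (Real.pi : ℂ) * Complex.I / (d : ℂ)) ^ (j : ℕ)

/-- The phase `ω̃`: `ω̃ = ω = exp(2πi/d)` for odd `d`, and `ω̃ = exp(iπ/d)` for even `d`. -/
noncomputable def omegaTilde (d : ℕ) : ℂ :=
  if Even d then Complex.exp ((Real.pi : ℂ) * Complex.I / (d : ℂ))
  else Complex.exp (2 * (Real.pi : ℂ) * Complex.I / (d : ℂ))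

/-- The `m`-fold tensor (Kronecker) product of single-qudit operators, as a matrix indexed by
configurations `Fin m → Fin d`. -/
noncomputable def tensorPow {m d : ℕ} (A : Fin m → Matrix (Fin d) (Fin d) ℂ) :
    Matrix (Fin m → Fin d) (Fin m → Fin d) ℂ :=
  Matrix.of fun f g => ∏ j, A j (f j) (g j)

/-- The `m`-qudit Pauli group (as a set of matrices): `m`-fold Kronecker products of elements
of the single-qudit Pauli group `⟨ω̃·I, X, Z⟩`, i.e. matrices `ω̃^c · ⊗_j X^{a_j} Z^{b_j}`. -/
def PauliSet (d m : ℕ) : Set (Matrix (Fin m → Fin d) (Fin m → Fin d) ℂ) :=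
  {P | ∃ (c : ℕ) (a b : Fin m → ℕ),
    P = omegaTilde d ^ c • tensorPow (fun j => shiftX d ^ a j * clockZ d ^ b j)}

/-- The `n`-qudit Pauli group expressed on the bipartitioned index type
`(Fin k → Fin d) × (Fin l → Fin d)`. -/
def PauliProd (d k l : ℕ) :
    Set (Matrix ((Fin k → Fin d) × (Fin l → Fin d)) ((Fin k → Fin d) × (Fin l → Fin d)) ℂ) :=
  {P | ∃ PA ∈ PauliSet d k, ∃ PB ∈ PauliSet d l, P = PA ⊗ₖ PB}

/-- `STAB₀`: the set of density matrices of the form `σ = dim⁻¹ Σ_{P∈G} P`, where `G` is a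
subgroup of the Pauli group whose elements pairwise commute, and `σ` is positive
semidefinite. -/
def Stab0 {I : Type*} [Fintype I] [DecidableEq I]
    (pauli : Set (Matrix I I ℂ)) (dim : ℕ) : Set (Matrix I I ℂ) :=
  {σ | ∃ G : Finset (Matrix I I ℂ),
    (↑G : Set (Matrix I I ℂ)) ⊆ pauli ∧
    (1 : Matrix I I ℂ) ∈ G ∧
    (∀ P ∈ G, ∀ Q ∈ G, P * Q ∈ G) ∧
    (∀ P ∈ G, ∃ Q ∈ G, P * Q = 1) ∧
    (∀ P ∈ G, ∀ Q ∈ G, P * Q = Q * P) ∧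
    σ = ((dim : ℂ))⁻¹ • ∑ P ∈ G, P ∧ σ.PosSemidef}

/-- The partial trace over the second tensor factor. -/
noncomputable def ptraceB {α β : Type*} [Fintype β]
    (ψ : Matrix (α × β) (α × β) ℂ) : Matrix α α ℂ :=
  Matrix.of fun a a' => ∑ b, ψ (a, b) (a', b)

/-- The relative stabilizer entropy of magic `M_RS(ρ) = min_{σ ∈ STAB₀} S(ρ‖σ)`. -/
noncomputable def Mrs {I : Type*} [Fintype I] [DecidableEq I]
    (pauli : Set (Matrix I I ℂ)) (dim : ℕ) (ρ : Matrix I I ℂ) : EReal :=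
  sInf {x : EReal | ∃ σ ∈ Stab0 pauli dim, x = qRelEntropy ρ σ}

/-- The infimum, over unitaries `U_A` acting on subsystem `A` alone, of the relative
stabilizer entropy of magic of `U_A ψ_A U_Aᴴ`, taken over `STAB₀^{(k)}`. -/
noncomputable def MrsLocalA (d k : ℕ)
    (ρ : Matrix (Fin k → Fin d) (Fin k → Fin d) ℂ) : EReal :=
  sInf {x : EReal | ∃ U ∈ Matrix.unitaryGroup (Fin k → Fin d) ℂ,
    x = Mrs (PauliSet d k) (d ^ k) (U * ρ * Uᴴ)}

/-- The non-local relative stabilizer entropy of magic: the infimum of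
`M_RS((U_A ⊗ U_B) ψ_AB (U_A ⊗ U_B)ᴴ)` over local unitaries `U_A ⊗ U_B`, taken over
`STAB₀^{(n)}`. -/
noncomputable def MrsNL (d n k : ℕ)
    (ψ : Matrix ((Fin k → Fin d) × (Fin (n - k) → Fin d))
      ((Fin k → Fin d) × (Fin (n - k) → Fin d)) ℂ) : EReal :=
  sInf {x : EReal | ∃ UA ∈ Matrix.unitaryGroup (Fin k → Fin d) ℂ,
    ∃ UB ∈ Matrix.unitaryGroup (Fin (n - k) → Fin d) ℂ,
    x = Mrs (PauliProd d k (n - k)) (d ^ n) ((UA ⊗ₖ UB) * ψ * (UA ⊗ₖ UB)ᴴ)}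

theorem Matrix.IsHermitian.eigenvalues_cases {n : Type*} [Fintype n] [DecidableEq n]
    {A : Matrix n n ℂ} (hA : A.IsHermitian) {c : ℝ} (h : A * A = (c : ℂ) • A) (i : n) :
    hA.eigenvalues i = 0 ∨ hA.eigenvalues i = c := by
  have h1 := hA.mulVec_eigenvectorBasis i
  set v : n → ℂ := ⇑(hA.eigenvectorBasis i) with hv
  have hv0 : v ≠ 0 := by
    intro h0
    apply (hA.eigenvectorBasis.orthonormal.ne_zero i)
    ext j
    exact congrFun h0 j
  have h2 : (A * A) *ᵥ v = hA.eigenvalues i • hA.eigenvalues i • v := by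
    rw [← Matrix.mulVec_mulVec, h1, Matrix.mulVec_smul, h1]
  rw [h, Matrix.smul_mulVec, h1] at h2
  obtain ⟨j, hj⟩ := Function.ne_iff.mp hv0
  have h3 := congrFun h2 j
  simp only [Pi.smul_apply, Complex.real_smul, smul_eq_mul] at h3
  simp only [Pi.zero_apply] at hj
  rw [← mul_assoc, ← mul_assoc] at h3
  have h4 := mul_right_cancel₀ hj h3
  have h5 : c * hA.eigenvalues i = hA.eigenvalues i * hA.eigenvalues i := by exact_mod_cast h4
  by_cases h6 : hA.eigenvalues i = 0
  · exact Or.inl h6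
  · exact Or.inr (mul_right_cancel₀ h6 h5).symm

theorem trace_mul_mlog_re {n : Type*} [Fintype n] [DecidableEq n]
    {A : Matrix n n ℂ} (hA : A.IsHermitian) :
    (A * mlog A).trace.re = -vnEntropy A := by
  have h1 : mlog A = hA.cfc (fun x => if x = 0 then 0 else Real.log x) := by
    simp [mlog, hA]
  have h2 : vnEntropy A = ∑ i, Real.negMulLog (hA.eigenvalues i) := by
    simp [vnEntropy, eigs, hA]
  rw [h1, h2]
  conv_lhs => enter [1, 1, 1]; rw [hA.spectral_theorem]
  rw [Matrix.IsHermitian.cfc, ← map_mul, Unitary.conjStarAlgAut_apply, Matrix.trace_mul_cycle,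
    Unitary.coe_star_mul_self, one_mul, Matrix.diagonal_mul_diagonal, Matrix.trace_diagonal,
    Complex.re_sum, ← Finset.sum_neg_distrib]
  refine Finset.sum_congr rfl fun i _ => ?_
  by_cases h : hA.eigenvalues i = 0 <;> simp [h, Real.negMulLog]

theorem mlog_of_mul_self {n : Type*} [Fintype n] [DecidableEq n]
    {A : Matrix n n ℂ} (hA : A.IsHermitian) {c : ℝ} (hc : c ≠ 0) (h : A * A = (c : ℂ) • A) :
    mlog A = ((Real.log c / c : ℝ) : ℂ) • A := by
  have h1 : mlog A = hA.cfc (fun x => if x = 0 then 0 else Real.log x) := by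
    simp [mlog, hA]
  rw [h1]
  conv_rhs => rw [hA.spectral_theorem]
  rw [Matrix.IsHermitian.cfc, ← map_smul]
  congr 1
  rw [← Matrix.diagonal_smul]
  congr 1
  funext i
  rcases hA.eigenvalues_cases h i with h0 | h0
  · simp [h0]
  · simp [h0, hc]

theorem Matrix.IsHermitian.re_trace_of_mul_self {n : Type*} [Fintype n] [DecidableEq n]
    {A : Matrix n n ℂ} (hA : A.IsHermitian) {c : ℝ} (h : A * A = (c : ℂ) • A) :
    A.trace.re = c * A.rank := by
  rw [hA.trace_eq_sum_eigenvalues, hA.rank_eq_card_non_zero_eigs, Fintype.card_subtype,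
    Complex.re_sum, Finset.card_filter]
  push_cast
  rw [Finset.mul_sum]
  refine Finset.sum_congr rfl fun i _ => ?_
  rcases hA.eigenvalues_cases h i with h0 | h0
  · simp [h0]
  · by_cases hc : c = 0 <;> simp [h0, hc]

theorem mul_eq_smul_of_ker_le {n : Type*} [Fintype n] [DecidableEq n]
    {ρ σ : Matrix n n ℂ} {c : ℝ} (h : σ * σ = (c : ℂ) • σ)
    (hker : ∀ v, σ *ᵥ v = 0 → ρ *ᵥ v = 0) : ρ * σ = (c : ℂ) • ρ := by
  have key : ρ * (σ - (c : ℂ) • 1) = 0 := by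
    apply Matrix.ext_of_mulVec_single
    intro i
    rw [← Matrix.mulVec_mulVec, Matrix.zero_mulVec]
    apply hker
    rw [Matrix.mulVec_mulVec, mul_sub, h, Matrix.mul_smul, mul_one, sub_self,
      Matrix.zero_mulVec]
  rw [mul_sub, sub_eq_zero] at key
  simpa using key

/-- The relative entropy with respect to a multiple of a projection. -/
theorem qRelEntropy_of_mul_self {n : Type*} [Fintype n] [DecidableEq n]
    {ρ σ : Matrix n n ℂ} {c : ℝ} (hρ : ρ.IsHermitian) (hρtr : ρ.trace = 1)
    (hσ : σ.IsHermitian) (hc : c ≠ 0) (h : σ * σ = (c : ℂ) • σ)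
    (hker : ∀ v, σ *ᵥ v = 0 → ρ *ᵥ v = 0) :
    qRelEntropy ρ σ = ((-vnEntropy ρ - Real.log c : ℝ) : EReal) := by
  rw [qRelEntropy, if_pos hker, trace_mul_mlog_re hρ, mlog_of_mul_self hσ hc h,
    Matrix.mul_smul, mul_eq_smul_of_ker_le h hker, smul_smul, Matrix.trace_smul, hρtr]
  congr 2
  rw [← Complex.ofReal_mul, smul_eq_mul, mul_one, Complex.ofReal_re]
  field_simp

theorem vnEntropy_of_mul_self {n : Type*} [Fintype n] [DecidableEq n]
    {A : Matrix n n ℂ} (hA : A.IsHermitian) (h : A * A = A) : vnEntropy A = 0 := by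
  have h' : A * A = ((1 : ℝ) : ℂ) • A := by simpa using h
  simp only [vnEntropy, eigs, dif_pos hA]
  refine Finset.sum_eq_zero fun i _ => ?_
  rcases hA.eigenvalues_cases h' i with h0 | h0 <;> simp [h0]

theorem vnEntropy_unitary_conj {n : Type*} [Fintype n] [DecidableEq n]
    {A U : Matrix n n ℂ} (hA : A.IsHermitian) (hU : U ∈ Matrix.unitaryGroup n ℂ) :
    vnEntropy (U * A * Uᴴ) = vnEntropy A := by
  have hB : (U * A * Uᴴ).IsHermitian := Matrix.isHermitian_mul_mul_conjTranspose U hA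
  have hU' : Uᴴ * U = 1 := Matrix.mem_unitaryGroup_iff'.mp hU
  have hcp : (U * A * Uᴴ).charpoly = A.charpoly := by
    rw [Matrix.charpoly_mul_comm, ← mul_assoc, hU', one_mul]
  simp only [vnEntropy, eigs, dif_pos hA, dif_pos hB]
  rw [(hB.eigenvalues_eq_eigenvalues_iff hA).mpr hcp]

/-- The entropy of a state is at least the min-entropy. -/
theorem neg_log_le_vnEntropy {n : Type*} [Fintype n] [DecidableEq n]
    {ρ : Matrix n n ℂ} (hρ : ρ.PosSemidef) (hρtr : ρ.trace = 1) {t : ℝ}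
    (h : ((t : ℂ) • (1 : Matrix n n ℂ) - ρ).PosSemidef) :
    -vnEntropy ρ ≤ Real.log t := by
  have hle : ∀ i, hρ.1.eigenvalues i ≤ t := by
    intro i
    have h1 := hρ.1.mulVec_eigenvectorBasis i
    have h2 := h.dotProduct_mulVec_nonneg (⇑(hρ.1.eigenvectorBasis i))
    set v : n → ℂ := ⇑(hρ.1.eigenvectorBasis i) with hv
    have h3 : star v ⬝ᵥ v = 1 := by
      have := hρ.1.eigenvectorBasis.orthonormal.1 i
      have h4 := inner_self_eq_norm_sq_to_K (𝕜 := ℂ) (hρ.1.eigenvectorBasis i)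
      rw [this, EuclideanSpace.inner_eq_star_dotProduct, dotProduct_comm] at h4
      simpa using h4
    rw [Matrix.sub_mulVec, h1, Matrix.smul_mulVec, Matrix.one_mulVec, dotProduct_sub,
      dotProduct_smul, dotProduct_smul, h3] at h2
    simp only [smul_eq_mul, mul_one, Complex.real_smul, sub_nonneg] at h2
    exact_mod_cast h2
  have hsum : ∑ i, hρ.1.eigenvalues i = 1 := by
    have := congrArg Complex.re hρ.1.trace_eq_sum_eigenvalues
    rw [hρtr, Complex.re_sum] at this
    simpa using this.symm
  simp only [vnEntropy, eigs, dif_pos hρ.1]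
  rw [← Finset.sum_neg_distrib, ← one_mul (Real.log t), ← hsum, Finset.sum_mul]
  refine Finset.sum_le_sum fun i _ => ?_
  rw [Real.negMulLog, neg_mul, neg_neg]
  rcases (hρ.eigenvalues_nonneg i).eq_or_lt with h0 | h0
  · simp [← h0]
  · exact mul_le_mul_of_nonneg_left (Real.log_le_log h0 (hle i)) h0.le

theorem ptraceB_sum {α β ι : Type*} [Fintype β] (s : Finset ι)
    (f : ι → Matrix (α × β) (α × β) ℂ) : ptraceB (∑ i ∈ s, f i) = ∑ i ∈ s, ptraceB (f i) := by
  ext a a'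
  simp only [ptraceB, Matrix.of_apply, Matrix.sum_apply]
  exact Finset.sum_comm

theorem ptraceB_smul {α β : Type*} [Fintype β] (c : ℂ) (ψ : Matrix (α × β) (α × β) ℂ) :
    ptraceB (c • ψ) = c • ptraceB ψ := by
  ext a a'
  simp [ptraceB, Finset.mul_sum]

theorem ptraceB_sub {α β : Type*} [Fintype β] (ψ φ : Matrix (α × β) (α × β) ℂ) :
    ptraceB (ψ - φ) = ptraceB ψ - ptraceB φ := by
  ext a a'
  simp [ptraceB]

theorem ptraceB_kronecker {α β : Type*} [Fintype β] (A : Matrix α α ℂ) (B : Matrix β β ℂ) :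
    ptraceB (A ⊗ₖ B) = B.trace • A := by
  ext a a'
  simp [ptraceB, Matrix.trace, ← Finset.mul_sum, mul_comm]

theorem trace_ptraceB {α β : Type*} [Fintype α] [Fintype β] (ψ : Matrix (α × β) (α × β) ℂ) :
    (ptraceB ψ).trace = ψ.trace := by
  simp [ptraceB, Matrix.trace, Fintype.sum_prod_type]

theorem Matrix.PosSemidef.ptraceB {α β : Type*} [Fintype β]
    {ψ : Matrix (α × β) (α × β) ℂ} (hψ : ψ.PosSemidef) : (ptraceB ψ).PosSemidef := by
  have : _root_.ptraceB ψ = ∑ b, ψ.submatrix (fun a => (a, b)) (fun a => (a, b)) := by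
    ext a a'
    simp [_root_.ptraceB, Matrix.sum_apply]
  rw [this]
  exact Matrix.posSemidef_sum _ fun b _ => hψ.submatrix _

theorem ptraceB_kronecker_one_mul {α β : Type*} [Fintype α] [Fintype β] [DecidableEq β]
    (U : Matrix α α ℂ) (ψ : Matrix (α × β) (α × β) ℂ) :
    ptraceB ((U ⊗ₖ (1 : Matrix β β ℂ)) * ψ) = U * ptraceB ψ := by
  ext a a'
  simp only [ptraceB, Matrix.of_apply, Matrix.mul_apply, Fintype.sum_prod_type,
    Matrix.kroneckerMap_apply, Matrix.one_apply, mul_ite, mul_one, mul_zero, ite_mul, zero_mul,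
    Finset.sum_ite_eq, Finset.mem_univ, if_true, Finset.mul_sum]
  exact Finset.sum_comm

theorem ptraceB_mul_kronecker_one {α β : Type*} [Fintype α] [Fintype β] [DecidableEq β]
    (ψ : Matrix (α × β) (α × β) ℂ) (V : Matrix α α ℂ) :
    ptraceB (ψ * (V ⊗ₖ (1 : Matrix β β ℂ))) = ptraceB ψ * V := by
  ext a a'
  simp only [ptraceB, Matrix.of_apply, Matrix.mul_apply, Fintype.sum_prod_type,
    Matrix.kroneckerMap_apply, Matrix.one_apply, mul_ite, mul_one, mul_zero,
    Finset.sum_ite_eq', Finset.mem_univ, if_true, Finset.sum_mul]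
  exact Finset.sum_comm

theorem ptraceB_one_kronecker_mul_comm {α β : Type*} [Fintype α] [Fintype β] [DecidableEq α]
    (ψ : Matrix (α × β) (α × β) ℂ) (V : Matrix β β ℂ) :
    ptraceB (((1 : Matrix α α ℂ) ⊗ₖ V) * ψ) = ptraceB (ψ * ((1 : Matrix α α ℂ) ⊗ₖ V)) := by
  ext a a'
  simp only [ptraceB, Matrix.of_apply, Matrix.mul_apply, Fintype.sum_prod_type,
    Matrix.kroneckerMap_apply, Matrix.one_apply, ite_mul, one_mul, zero_mul, mul_ite, mul_zero,
    Finset.sum_ite_irrel, Finset.sum_const_zero,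
    Finset.sum_ite_eq', Finset.sum_ite_eq, Finset.mem_univ, if_true]
  rw [Finset.sum_comm]
  exact Finset.sum_congr rfl fun _ _ => Finset.sum_congr rfl fun _ _ => mul_comm _ _

theorem ptraceB_local_unitary {α β : Type*} [Fintype α] [Fintype β] [DecidableEq α]
    [DecidableEq β] (ψ : Matrix (α × β) (α × β) ℂ) (U : Matrix α α ℂ) {V : Matrix β β ℂ}
    (hV : V ∈ Matrix.unitaryGroup β ℂ) :
    ptraceB ((U ⊗ₖ V) * ψ * (U ⊗ₖ V)ᴴ) = U * ptraceB ψ * Uᴴ := by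
  have h1 : U ⊗ₖ V = (U ⊗ₖ 1) * (1 ⊗ₖ V) := by
    rw [← Matrix.mul_kronecker_mul, mul_one, one_mul]
  have h2 : (U ⊗ₖ V)ᴴ = (1 ⊗ₖ Vᴴ) * (Uᴴ ⊗ₖ 1) := by
    rw [Matrix.conjTranspose_kronecker, ← Matrix.mul_kronecker_mul, mul_one, one_mul]
  have h3 : (U ⊗ₖ V) * ψ * (U ⊗ₖ V)ᴴ =
      (U ⊗ₖ 1) * ((1 ⊗ₖ V) * (ψ * (1 ⊗ₖ Vᴴ))) * (Uᴴ ⊗ₖ 1) := by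
    rw [h2, h1]
    simp only [mul_assoc]
  have hV' : Vᴴ * V = 1 := Matrix.mem_unitaryGroup_iff'.mp hV
  rw [h3, ptraceB_mul_kronecker_one, ptraceB_kronecker_one_mul, ptraceB_one_kronecker_mul_comm,
    mul_assoc ψ, ← Matrix.mul_kronecker_mul, mul_one, hV', Matrix.one_kronecker_one, mul_one]

theorem mul_sum_eq_of_mem {R : Type*} [Ring R] [DecidableEq R] {G : Finset R}
    (hmul : ∀ P ∈ G, ∀ Q ∈ G, P * Q ∈ G) (hinv : ∀ P ∈ G, ∃ Q ∈ G, P * Q = 1)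
    (hcomm : ∀ P ∈ G, ∀ Q ∈ G, P * Q = Q * P) {P : R} (hP : P ∈ G) :
    P * ∑ Q ∈ G, Q = ∑ Q ∈ G, Q := by
  obtain ⟨P', hP', hPP'⟩ := hinv P hP
  have hinj : Set.InjOn (fun Q => P * Q) (G : Set R) := by
    intro Q _ Q' _ h
    have h' : P' * (P * Q) = P' * (P * Q') := congrArg (P' * ·) h
    rwa [← mul_assoc, ← mul_assoc, ← hcomm P hP P' hP', hPP', one_mul, one_mul] at h'
  have himg : G.image (fun Q => P * Q) = G := by
    apply Finset.eq_of_subset_of_card_le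
    · intro Q hQ
      obtain ⟨Q', hQ', rfl⟩ := Finset.mem_image.mp hQ
      exact hmul P hP Q' hQ'
    · rw [Finset.card_image_of_injOn hinj]
  conv_rhs => rw [← himg, Finset.sum_image hinj]
  rw [Finset.mul_sum]

theorem Stab0.exists_mul_self {I : Type*} [Fintype I] [DecidableEq I]
    {pauli : Set (Matrix I I ℂ)} {dim : ℕ} (hdim : dim ≠ 0) {σ : Matrix I I ℂ}
    (hσ : σ ∈ Stab0 pauli dim) : ∃ c : ℝ, 0 < c ∧ σ * σ = (c : ℂ) • σ := by
  obtain ⟨G, -, h1, hmul, hinv, hcomm, rfl, -⟩ := hσ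
  refine ⟨(dim : ℝ)⁻¹ * G.card, ?_, ?_⟩
  · have : 0 < G.card := Finset.card_pos.mpr ⟨1, h1⟩
    positivity
  · rw [Matrix.smul_mul, Matrix.mul_smul, Finset.sum_mul,
      Finset.sum_congr rfl fun P hP => mul_sum_eq_of_mem hmul hinv hcomm hP, Finset.sum_const]
    simp only [← Nat.cast_smul_eq_nsmul ℂ, smul_smul]
    push_cast
    ring_nf

theorem shiftX_pow_apply (d a : ℕ) (i j : Fin d) :
    (shiftX d ^ a) i j = if (i : ℕ) = ((j : ℕ) + a) % d then 1 else 0 := by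
  induction a generalizing i j with
  | zero => simp [Matrix.one_apply, Fin.ext_iff, Nat.mod_eq_of_lt j.2]
  | succ a ih =>
    have hd : 0 < d := j.pos
    rw [pow_succ, Matrix.mul_apply]
    have hj : ((j : ℕ) + 1) % d < d := Nat.mod_lt _ hd
    rw [Finset.sum_eq_single (⟨((j : ℕ) + 1) % d, hj⟩ : Fin d)]
    · rw [ih]
      simp only [shiftX, Matrix.of_apply, if_true, mul_one, Nat.mod_add_mod]
      rw [add_assoc, add_comm 1 a]
    · intro b _ hb
      have : ¬ (b : ℕ) = ((j : ℕ) + 1) % d := fun h => hb (Fin.ext h)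
      simp [shiftX, this]
    · simp

theorem clockZ_pow (d b : ℕ) : clockZ d ^ b = Matrix.diagonal fun j : Fin d =>
    (Complex.exp (2 * (Real.pi : ℂ) * Complex.I / (d : ℂ)) ^ b) ^ (j : ℕ) := by
  rw [clockZ, Matrix.diagonal_pow]
  congr 1
  funext j
  simp only [Pi.pow_apply]
  rw [← pow_mul, ← pow_mul, mul_comm b]

theorem trace_shiftX_mul_clockZ (d : ℕ) (hd : d ≠ 0) (a b : ℕ) :
    (shiftX d ^ a * clockZ d ^ b).trace = 0 ∨ shiftX d ^ a * clockZ d ^ b = 1 := by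
  have hω := Complex.isPrimitiveRoot_exp d hd
  set ω := Complex.exp (2 * (Real.pi : ℂ) * Complex.I / (d : ℂ)) with hωdef
  rw [clockZ_pow]
  by_cases ha : d ∣ a
  · have hX : shiftX d ^ a = 1 := by
      ext i j
      obtain ⟨q, rfl⟩ := ha
      simp [shiftX_pow_apply, Matrix.one_apply, Fin.ext_iff, Nat.mod_eq_of_lt j.2]
    rw [hX, one_mul]
    by_cases hb : ω ^ b = 1
    · right
      rw [← hωdef, hb]
      simp
    · left
      rw [Matrix.trace_diagonal, ← hωdef, Fin.sum_univ_eq_sum_range (fun j => (ω ^ b) ^ j) d,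
        geom_sum_eq hb, ← pow_mul, mul_comm, pow_mul, hω.pow_eq_one, one_pow, sub_self, zero_div]
  · left
    refine Finset.sum_eq_zero fun j _ => ?_
    rw [Matrix.diag_apply, Matrix.mul_diagonal, shiftX_pow_apply, if_neg, zero_mul]
    intro h
    apply ha
    have h' : (j : ℕ) + 0 ≡ j + a [MOD d] := by
      rw [Nat.ModEq, add_zero, Nat.mod_eq_of_lt j.2]
      exact h
    exact (Nat.modEq_zero_iff_dvd.mp (Nat.ModEq.add_left_cancel' _ h').symm)

theorem trace_tensorPow {m d : ℕ} (A : Fin m → Matrix (Fin d) (Fin d) ℂ) :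
    (tensorPow A).trace = ∏ j, (A j).trace := by
  simp only [Matrix.trace, Matrix.diag_apply, tensorPow, Matrix.of_apply]
  rw [Finset.prod_univ_sum, Fintype.piFinset_univ]

theorem tensorPow_one {m d : ℕ} :
    tensorPow (fun _ : Fin m => (1 : Matrix (Fin d) (Fin d) ℂ)) = 1 := by
  ext f g
  simp only [tensorPow, Matrix.of_apply, Matrix.one_apply, Finset.prod_ite_zero,
    Finset.prod_const_one, Finset.mem_univ, true_imp_iff, funext_iff]

theorem PauliSet.trace_eq_zero_or {d m : ℕ} (hd : d ≠ 0)
    {P : Matrix (Fin m → Fin d) (Fin m → Fin d) ℂ} (hP : P ∈ PauliSet d m) :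
    P.trace = 0 ∨ ∃ c : ℕ, P = omegaTilde d ^ c • (1 : Matrix _ _ ℂ) := by
  obtain ⟨c, a, b, rfl⟩ := hP
  by_cases h : ∀ j, shiftX d ^ a j * clockZ d ^ b j = 1
  · right
    exact ⟨c, by simp only [h, tensorPow_one]⟩
  · left
    push Not at h
    obtain ⟨j, hj⟩ := h
    rw [Matrix.trace_smul, trace_tensorPow, Finset.prod_eq_zero (Finset.mem_univ j)
      ((trace_shiftX_mul_clockZ d hd (a j) (b j)).resolve_right hj), smul_zero]

theorem PauliSet.smul_mem {d m : ℕ} (c : ℕ) {P : Matrix (Fin m → Fin d) (Fin m → Fin d) ℂ}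
    (hP : P ∈ PauliSet d m) : omegaTilde d ^ c • P ∈ PauliSet d m := by
  obtain ⟨c', a, b, rfl⟩ := hP
  exact ⟨c + c', a, b, by rw [smul_smul, pow_add]⟩

theorem Stab0.trace_eq_one {d k : ℕ} (hd : d ≠ 0)
    {σ : Matrix (Fin k → Fin d) (Fin k → Fin d) ℂ}
    (hσ : σ ∈ Stab0 (PauliSet d k) (d ^ k)) (hσ0 : σ ≠ 0) : σ.trace = 1 := by
  obtain ⟨G, hG, h1, hmul, hinv, hcomm, rfl, -⟩ := hσ
  have hT : ∑ P ∈ G, P ≠ 0 := fun h => hσ0 (by rw [h, smul_zero])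
  rw [Matrix.trace_smul, Matrix.trace_sum, Finset.sum_eq_single_of_mem 1 h1]
  · have : (d : ℂ) ≠ 0 := Nat.cast_ne_zero.mpr hd
    simp [Matrix.trace_one, this]
  · intro P hP hP1
    refine (PauliSet.trace_eq_zero_or hd (hG hP)).resolve_right ?_
    rintro ⟨c, hc⟩
    apply hP1
    have h := mul_sum_eq_of_mem hmul hinv hcomm hP
    rw [hc, Matrix.smul_mul, one_mul, ← sub_eq_zero] at h
    nth_rw 2 [← one_smul ℂ (∑ P ∈ G, P)] at h
    rw [← sub_smul] at h
    have := (smul_eq_zero.mp h).resolve_right hT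
    rw [hc, sub_eq_zero.mp this, one_smul]

theorem kronecker_one_injective {α β : Type*} [DecidableEq β] [Nonempty β] :
    Function.Injective (fun P : Matrix α α ℂ => P ⊗ₖ (1 : Matrix β β ℂ)) := by
  intro P Q h
  ext a a'
  have b := Classical.arbitrary β
  simpa using congrFun (congrFun h (a, b)) (a', b)

theorem PauliProd.ptraceB_eq_zero_or {d k l : ℕ} (hd : d ≠ 0)
    {P : Matrix ((Fin k → Fin d) × (Fin l → Fin d)) ((Fin k → Fin d) × (Fin l → Fin d)) ℂ}
    (hP : P ∈ PauliProd d k l) :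
    ptraceB P = 0 ∨ ∃ Q ∈ PauliSet d k, P = Q ⊗ₖ 1 := by
  obtain ⟨PA, hA, PB, hB, rfl⟩ := hP
  rcases PauliSet.trace_eq_zero_or hd hB with h | ⟨c, rfl⟩
  · left
    rw [ptraceB_kronecker, h, zero_smul]
  · exact Or.inr ⟨_, PauliSet.smul_mem c hA, by rw [Matrix.kronecker_smul, Matrix.smul_kronecker]⟩

/-- The partial trace of a stabilizer state is a stabilizer state. -/
theorem Stab0.ptraceB_mem {d k l : ℕ} (hd : d ≠ 0)
    {σ : Matrix ((Fin k → Fin d) × (Fin l → Fin d)) ((Fin k → Fin d) × (Fin l → Fin d)) ℂ}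
    (hσ : σ ∈ Stab0 (PauliProd d k l) (d ^ (k + l))) :
    ptraceB σ ∈ Stab0 (PauliSet d k) (d ^ k) := by
  have : NeZero d := ⟨hd⟩
  obtain ⟨G, hG, h1, hmul, hinv, hcomm, hσG, hpos⟩ := hσ
  have hinj : Function.Injective (fun P : Matrix (Fin k → Fin d) (Fin k → Fin d) ℂ =>
    P ⊗ₖ (1 : Matrix (Fin l → Fin d) (Fin l → Fin d) ℂ)) := kronecker_one_injective
  have htr : (1 : Matrix (Fin l → Fin d) (Fin l → Fin d) ℂ).trace = (d : ℂ) ^ l := by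
    simp [Matrix.trace_one]
  have hdl : (d : ℂ) ^ l ≠ 0 := pow_ne_zero _ (Nat.cast_ne_zero.mpr hd)
  refine ⟨G.preimage _ hinj.injOn, ?_, ?_, ?_, ?_, ?_, ?_, hpos.ptraceB⟩
  · intro P hP
    have hP : P ⊗ₖ 1 ∈ G := by simpa using hP
    rcases PauliProd.ptraceB_eq_zero_or hd (hG hP) with h | ⟨Q, hQ, h⟩
    · exfalso
      rw [ptraceB_kronecker, htr, smul_eq_zero] at h
      obtain ⟨Q, -, hQ⟩ := hinv _ hP
      rw [h.resolve_left hdl, Matrix.zero_kronecker, zero_mul] at hQ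
      exact zero_ne_one hQ
    · rwa [hinj h]
  · simpa using h1
  · intro P hP Q hQ
    rw [Finset.mem_preimage] at *
    simpa [← Matrix.mul_kronecker_mul] using hmul _ hP _ hQ
  · intro P hP
    rw [Finset.mem_preimage] at hP
    obtain ⟨Q, hQ, hPQ⟩ := hinv _ hP
    have h2 := congrArg ptraceB hPQ
    rw [ptraceB_kronecker_one_mul, ← Matrix.one_kronecker_one, ptraceB_kronecker, htr] at h2
    have h3 : P * ((((d : ℂ) ^ l)⁻¹) • ptraceB Q) = 1 := by
      rw [Matrix.mul_smul, h2, smul_smul, inv_mul_cancel₀ hdl, one_smul]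
    refine ⟨_, ?_, h3⟩
    rw [Finset.mem_preimage]
    have h4 : (P ⊗ₖ (1 : Matrix (Fin l → Fin d) (Fin l → Fin d) ℂ)) *
        (((((d : ℂ) ^ l)⁻¹) • ptraceB Q) ⊗ₖ 1) = 1 := by
      rw [← Matrix.mul_kronecker_mul, h3, one_mul, Matrix.one_kronecker_one]
    rwa [← left_inv_eq_right_inv (mul_eq_one_comm.mp hPQ) h4]
  · intro P hP Q hQ
    rw [Finset.mem_preimage] at *
    apply hinj
    simpa [← Matrix.mul_kronecker_mul] using hcomm _ hP _ hQ
  · have hsum := Finset.sum_preimage (fun P : Matrix (Fin k → Fin d) (Fin k → Fin d) ℂ =>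
      P ⊗ₖ (1 : Matrix (Fin l → Fin d) (Fin l → Fin d) ℂ)) G hinj.injOn ptraceB (by
        intro P hP hPr
        refine (PauliProd.ptraceB_eq_zero_or hd (hG hP)).resolve_right ?_
        rintro ⟨Q, -, rfl⟩
        exact hPr ⟨Q, rfl⟩)
    simp only [ptraceB_kronecker, htr] at hsum
    rw [← Finset.smul_sum] at hsum
    rw [hσG, ptraceB_smul, ptraceB_sum, ← hsum, smul_smul]
    congr 1
    push_cast
    rw [pow_add]
    field_simp

theorem Matrix.PosSemidef.ker_le {n : Type*} [Fintype n]
    {ρ σ : Matrix n n ℂ} (hρ : ρ.PosSemidef) {c : ℝ} (hc : 0 < c)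
    (h : (σ - (c : ℂ) • ρ).PosSemidef) (v : n → ℂ) (hv : σ *ᵥ v = 0) : ρ *ᵥ v = 0 := by
  have h1 := h.dotProduct_mulVec_nonneg v
  have h2 := hρ.dotProduct_mulVec_nonneg v
  rw [Matrix.sub_mulVec, hv, zero_sub, dotProduct_neg, Matrix.smul_mulVec, dotProduct_smul,
    Left.nonneg_neg_iff, smul_eq_mul] at h1
  have hc' : (0 : ℂ) < c := by exact_mod_cast hc
  have h3 : star v ⬝ᵥ (ρ *ᵥ v) ≤ 0 := by
    by_contra h4
    have h5 : 0 < star v ⬝ᵥ (ρ *ᵥ v) := lt_of_le_of_ne h2 fun h6 => h4 h6.symm.le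
    exact absurd h1 (not_le_of_gt (mul_pos hc' h5))
  exact (hρ.dotProduct_mulVec_zero_iff v).mp (le_antisymm h3 h2)

theorem log_rank_sub_vnEntropy_le_qRelEntropy {d k : ℕ} (hd : d ≠ 0)
    {ρ σ : Matrix (Fin k → Fin d) (Fin k → Fin d) ℂ} (hρ : ρ.PosSemidef) (hρtr : ρ.trace = 1)
    (hσ : σ ∈ Stab0 (PauliSet d k) (d ^ k)) :
    ((Real.log (ρ.rank : ℝ) - vnEntropy ρ : ℝ) : EReal) ≤ qRelEntropy ρ σ := by
  by_cases hker : ∀ v, σ *ᵥ v = 0 → ρ *ᵥ v = 0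
  swap
  · rw [qRelEntropy, if_neg hker]
    exact le_top
  obtain ⟨c, hc, hσσ⟩ := Stab0.exists_mul_self (pow_ne_zero _ hd) hσ
  have hσpos : σ.PosSemidef := hσ.choose_spec.2.2.2.2.2.2
  have hρσ := mul_eq_smul_of_ker_le hσσ hker
  have hσ0 : σ ≠ 0 := by
    rintro rfl
    rw [mul_zero] at hρσ
    have := congrArg Matrix.trace hρσ
    rw [Matrix.trace_zero, Matrix.trace_smul, hρtr, smul_eq_mul, mul_one] at this
    exact hc.ne (by exact_mod_cast this)
  have htr := hσpos.1.re_trace_of_mul_self hσσ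
  rw [Stab0.trace_eq_one hd hσ hσ0, Complex.one_re] at htr
  have hrank : ρ.rank ≤ σ.rank := by
    have h1 : ρ = (ρ * ((c : ℂ)⁻¹ • 1)) * σ := by
      have : (c : ℂ) ≠ 0 := by exact_mod_cast hc.ne'
      rw [mul_assoc, Matrix.smul_mul, one_mul, Matrix.mul_smul, hρσ, smul_smul,
        inv_mul_cancel₀ this, one_smul]
    conv_lhs => rw [h1]
    exact Matrix.rank_mul_le_right _ _
  rw [qRelEntropy_of_mul_self hρ.1 hρtr hσpos.1 hc.ne' hσσ hker, EReal.coe_le_coe_iff]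
  have h2 : Real.log ρ.rank ≤ Real.log σ.rank := by
    rcases Nat.eq_zero_or_pos ρ.rank with h0 | h0
    · rw [h0, Nat.cast_zero, Real.log_zero]
      exact Real.log_natCast_nonneg _
    · exact Real.log_le_log (by exact_mod_cast h0) (by exact_mod_cast hrank)
  have h3 : Real.log c + Real.log σ.rank = 0 := by
    have hr : (σ.rank : ℝ) ≠ 0 := by
      intro h
      rw [h] at htr
      simp at htr
    rw [← Real.log_mul hc.ne' hr, ← htr, Real.log_one]
  linarith

theorem qRelEntropy_ptraceB_le {d k l : ℕ} (hd : d ≠ 0)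
    {φ σ : Matrix ((Fin k → Fin d) × (Fin l → Fin d)) ((Fin k → Fin d) × (Fin l → Fin d)) ℂ}
    (hφ : φ.PosSemidef) (hφtr : φ.trace = 1) (hφp : φ * φ = φ)
    (hσ : σ ∈ Stab0 (PauliProd d k l) (d ^ (k + l))) :
    qRelEntropy (ptraceB φ) (ptraceB σ) ≤ qRelEntropy φ σ := by
  by_cases hker : ∀ v, σ *ᵥ v = 0 → φ *ᵥ v = 0
  swap
  · rw [qRelEntropy.eq_def φ, if_neg hker]
    exact le_top
  obtain ⟨c, hc, hσσ⟩ := Stab0.exists_mul_self (pow_ne_zero _ hd) hσ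
  have hσpos : σ.PosSemidef := hσ.choose_spec.2.2.2.2.2.2
  have hσA := Stab0.ptraceB_mem hd hσ
  obtain ⟨cA, hcA, hσσA⟩ := Stab0.exists_mul_self (pow_ne_zero _ hd) hσA
  have hφσ := mul_eq_smul_of_ker_le hσσ hker
  have hσφ : σ * φ = (c : ℂ) • φ := by
    have := congrArg Matrix.conjTranspose hφσ
    rwa [Matrix.conjTranspose_mul, hσpos.1.eq, hφ.1.eq, Matrix.conjTranspose_smul, hφ.1.eq,
      Complex.star_def, Complex.conj_ofReal] at this
  have hle : (σ - (c : ℂ) • φ).PosSemidef := by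
    have hH : (σ - (c : ℂ) • φ)ᴴ = σ - (c : ℂ) • φ := by
      rw [Matrix.conjTranspose_sub, Matrix.conjTranspose_smul, hφ.1.eq, hσpos.1.eq,
        Complex.star_def, Complex.conj_ofReal]
    have h1 : (σ - (c : ℂ) • φ) = (c : ℂ)⁻¹ • ((σ - (c : ℂ) • φ)ᴴ * (σ - (c : ℂ) • φ)) := by
      have : (c : ℂ) ≠ 0 := by exact_mod_cast hc.ne'
      rw [hH, sub_mul, mul_sub, mul_sub, hσσ, Matrix.mul_smul, Matrix.smul_mul, Matrix.smul_mul,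
        Matrix.mul_smul, hφσ, hσφ, hφp, sub_self, sub_zero, ← smul_sub, smul_smul,
        inv_mul_cancel₀ this, one_smul]
    rw [h1]
    refine (Matrix.posSemidef_conjTranspose_mul_self _).smul ?_
    rw [← Complex.ofReal_inv]
    exact_mod_cast (inv_pos.mpr hc).le
  have hleA : (ptraceB σ - (c : ℂ) • ptraceB φ).PosSemidef := by
    rw [← ptraceB_smul, ← ptraceB_sub]
    exact hle.ptraceB
  have hone : ((cA : ℂ) • (1 : Matrix (Fin k → Fin d) (Fin k → Fin d) ℂ)
      - ptraceB σ).PosSemidef := by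
    have hσAh := hσpos.ptraceB.1
    set τ := ptraceB σ
    have hH : ((cA : ℂ) • (1 : Matrix (Fin k → Fin d) (Fin k → Fin d) ℂ) - τ)ᴴ
        = (cA : ℂ) • 1 - τ := by
      rw [Matrix.conjTranspose_sub, Matrix.conjTranspose_smul, hσAh.eq,
        Matrix.conjTranspose_one, Complex.star_def, Complex.conj_ofReal]
    have h1 : ((cA : ℂ) • (1 : Matrix (Fin k → Fin d) (Fin k → Fin d) ℂ) - τ) =
        (cA : ℂ)⁻¹ • (((cA : ℂ) • 1 - τ)ᴴ * ((cA : ℂ) • 1 - τ)) := by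
      have : (cA : ℂ) ≠ 0 := by exact_mod_cast hcA.ne'
      rw [hH, sub_mul, mul_sub τ, hσσA, Matrix.mul_smul, mul_one, sub_self, sub_zero,
        Matrix.smul_mul, one_mul, smul_smul, inv_mul_cancel₀ this, one_smul]
    rw [h1]
    refine (Matrix.posSemidef_conjTranspose_mul_self _).smul ?_
    rw [← Complex.ofReal_inv]
    exact_mod_cast (inv_pos.mpr hcA).le
  have hbound : (((cA / c : ℝ) : ℂ) • (1 : Matrix (Fin k → Fin d) (Fin k → Fin d) ℂ)
      - ptraceB φ).PosSemidef := by
    have h1 := (hone.add hleA).smul (a := (c : ℂ)⁻¹) (by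
      rw [← Complex.ofReal_inv]
      exact_mod_cast (inv_pos.mpr hc).le)
    have : (c : ℂ) ≠ 0 := by exact_mod_cast hc.ne'
    rwa [sub_add_sub_cancel, smul_sub, smul_smul, smul_smul, inv_mul_cancel₀ this, one_smul,
      inv_mul_eq_div, ← Complex.ofReal_div] at h1
  have hφAtr : (ptraceB φ).trace = 1 := by rw [trace_ptraceB, hφtr]
  rw [qRelEntropy_of_mul_self hφ.1 hφtr hσpos.1 hc.ne' hσσ hker,
    qRelEntropy_of_mul_self hφ.ptraceB.1 hφAtr hσpos.ptraceB.1 hcA.ne' hσσA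
      (hφ.ptraceB.ker_le hc hleA), EReal.coe_le_coe_iff, vnEntropy_of_mul_self hφ.1 hφp]
  have := neg_log_le_vnEntropy hφ.ptraceB hφAtr hbound
  rw [Real.log_div hcA.ne' hc.ne'] at this
  linarith

/-- Compact singular value decomposition. -/
theorem Matrix.exists_compact_svd {α β : Type*} [Fintype α] [DecidableEq α] [Fintype β]
    (M : Matrix α β ℂ) :
    ∃ (S : Finset α) (E : Matrix α S ℂ) (D : S → ℂ) (F : Matrix S β ℂ),
      S.card = (M * Mᴴ).rank ∧ Eᴴ * E = 1 ∧ F * Fᴴ = 1 ∧ M = E * Matrix.diagonal D * F := by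
  have hpos := Matrix.posSemidef_self_mul_conjTranspose M
  have hH := hpos.1
  set μ := hH.eigenvalues with hμ
  set W : Matrix α α ℂ := hH.eigenvectorUnitary.1 with hW
  have hWW : Wᴴ * W = 1 := Matrix.mem_unitaryGroup_iff'.mp hH.eigenvectorUnitary.2
  have hWW' : W * Wᴴ = 1 := Matrix.mem_unitaryGroup_iff.mp hH.eigenvectorUnitary.2
  have hdiag : Wᴴ * (M * Mᴴ) * W = Matrix.diagonal fun i => (μ i : ℂ) := by
    conv_lhs => enter [1, 2]; rw [hH.spectral_theorem, Unitary.conjStarAlgAut_apply]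
    change Wᴴ * (W * _ * Wᴴ) * W = _
    rw [mul_assoc, mul_assoc, hWW, mul_one, ← mul_assoc, hWW, one_mul]
    rfl
  set S := Finset.univ.filter fun i => μ i ≠ 0 with hS
  have hrow : ∀ i, μ i = 0 → (Wᴴ * M) i = 0 := by
    intro i hi
    have h1 := congrFun (congrFun hdiag i) i
    have h2 : Wᴴ * (M * Mᴴ) * W = (Wᴴ * M) * (Wᴴ * M)ᴴ := by
      rw [Matrix.conjTranspose_mul, Matrix.conjTranspose_conjTranspose]
      simp only [mul_assoc, Matrix.mul_assoc]
    rw [h2, Matrix.diagonal_apply_eq, hi, Matrix.mul_apply'] at h1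
    rw [Complex.ofReal_zero] at h1
    exact dotProduct_self_star_eq_zero.mp h1
  refine ⟨S, W.submatrix id Subtype.val, fun i => (Real.sqrt (μ i) : ℂ),
    Matrix.of fun i b => (Real.sqrt (μ i) : ℂ)⁻¹ * (Wᴴ * M) i b, ?_, ?_, ?_, ?_⟩
  · rw [hH.rank_eq_card_non_zero_eigs, Fintype.card_subtype]
  · ext i j
    have := congrFun (congrFun hWW i) j
    rw [Matrix.mul_apply, Matrix.one_apply] at this
    rw [Matrix.mul_apply, Matrix.one_apply]
    exact this.trans (if_congr Subtype.ext_iff.symm rfl rfl)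
  · ext i j
    have h1 := congrFun (congrFun hdiag i) j
    have h2 : Wᴴ * (M * Mᴴ) * W = (Wᴴ * M) * (Wᴴ * M)ᴴ := by
      rw [Matrix.conjTranspose_mul, Matrix.conjTranspose_conjTranspose]
      simp only [mul_assoc, Matrix.mul_assoc]
    rw [h2, Matrix.mul_apply] at h1
    have hi : μ i ≠ 0 := (Finset.mem_filter.mp i.2).2
    have hi' : (Real.sqrt (μ i) : ℂ) * (Real.sqrt (μ i) : ℂ) = μ i := by
      rw [← Complex.ofReal_mul, Real.mul_self_sqrt (hpos.eigenvalues_nonneg i)]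
    have hi0 : (Real.sqrt (μ i) : ℂ) ≠ 0 := by
      intro h
      rw [h, zero_mul] at hi'
      exact hi (by exact_mod_cast hi'.symm)
    rw [Matrix.mul_apply]
    calc _ = (Real.sqrt (μ i) : ℂ)⁻¹ * (Real.sqrt (μ j) : ℂ)⁻¹ *
          ∑ b, (Wᴴ * M) i b * (Wᴴ * M)ᴴ b j := by
          rw [Finset.mul_sum]
          refine Finset.sum_congr rfl fun b _ => ?_
          simp only [Matrix.of_apply, Matrix.conjTranspose_apply, star_mul', star_inv₀,
            Complex.star_def, Complex.conj_ofReal]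
          ring
      _ = _ := by
          rw [h1, Matrix.diagonal_apply, Matrix.one_apply]
          by_cases hij : i = j
          · subst hij
            rw [if_pos rfl, if_pos rfl, ← hi']
            field_simp
          · rw [if_neg (fun h => hij (Subtype.ext h)), if_neg hij, mul_zero]
  · have h1 : M = W * (Wᴴ * M) := by rw [← Matrix.mul_assoc, hWW', Matrix.one_mul]
    ext a b
    conv_lhs => rw [h1, Matrix.mul_apply]
    rw [Matrix.mul_apply, ← Finset.sum_subset (Finset.subset_univ S), ← Finset.sum_coe_sort S]
    · refine Finset.sum_congr rfl fun i _ => ?_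
      have hi : μ i ≠ 0 := (Finset.mem_filter.mp i.2).2
      have hi0 : (Real.sqrt (μ i) : ℂ) ≠ 0 := by
        rw [Complex.ofReal_ne_zero, Real.sqrt_ne_zero (hpos.eigenvalues_nonneg i)]
        exact hi
      rw [Matrix.mul_diagonal, Matrix.submatrix_apply, Matrix.of_apply, mul_assoc,
        mul_inv_cancel_left₀ hi0]
      rfl
    · intro i _ hi
      have : μ i = 0 := by simpa [hS] using hi
      rw [hrow i this, Pi.zero_apply, mul_zero]

/-- An isometry is carried to a coordinate inclusion by a unitary. -/
theorem Matrix.exists_unitary_mul_eq_submatrix {α S : Type*} [Fintype α] [DecidableEq α]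
    [Fintype S] [DecidableEq S] {E : Matrix α S ℂ} (hE : Eᴴ * E = 1) {i : S → α}
    (hi : Function.Injective i) :
    ∃ U ∈ Matrix.unitaryGroup α ℂ, U * E = (1 : Matrix α α ℂ).submatrix id i := by
  set w : S → EuclideanSpace ℂ α := fun s => WithLp.toLp 2 fun a => E a s with hw
  have hinner : ∀ s t, inner ℂ (w s) (w t) = if s = t then 1 else 0 := by
    intro s t
    have := congrFun (congrFun hE s) t
    rw [Matrix.mul_apply, Matrix.one_apply] at this
    rw [← this, EuclideanSpace.inner_eq_star_dotProduct, dotProduct]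
    exact Finset.sum_congr rfl fun a _ => by simp [hw, mul_comm]
  set v : α → EuclideanSpace ℂ α := Function.extend i w 0 with hv
  have hvi : ∀ s, v (i s) = w s := fun s => hi.extend_apply _ _ _
  have hvo : Orthonormal ℂ ((Set.range i).domRestrict v) := by
    rw [orthonormal_iff_ite]
    rintro ⟨_, s, rfl⟩ ⟨_, t, rfl⟩
    rw [Set.domRestrict_apply, Set.domRestrict_apply, hvi, hvi, hinner]
    exact if_congr ⟨fun h => by subst h; rfl, fun h => hi (congrArg Subtype.val h)⟩ rfl rfl
  obtain ⟨b, hb⟩ := hvo.exists_orthonormalBasis_extension_of_card_eq (by simp)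
  have hbi : ∀ s, b (i s) = w s := fun s => (hb _ ⟨s, rfl⟩).trans (hvi s)
  have hbb := orthonormal_iff_ite.mp b.orthonormal
  refine ⟨(Matrix.of fun a j => b j a)ᴴ, ?_, ?_⟩
  · rw [Matrix.mem_unitaryGroup_iff, Matrix.star_eq_conjTranspose,
      Matrix.conjTranspose_conjTranspose]
    ext j j'
    rw [Matrix.mul_apply, Matrix.one_apply, ← hbb j j',
      EuclideanSpace.inner_eq_star_dotProduct, dotProduct]
    exact Finset.sum_congr rfl fun a _ => by simp [mul_comm]
  · ext j s
    rw [Matrix.mul_apply, Matrix.submatrix_apply, Matrix.one_apply, id, ← hbb j (i s), hbi,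
      EuclideanSpace.inner_eq_star_dotProduct, dotProduct]
    exact Finset.sum_congr rfl fun a _ => by simp [hw, mul_comm]

theorem exists_eq_vecMulVec_of_pure {n : Type*} [Fintype n] [DecidableEq n] {ψ : Matrix n n ℂ}
    (hψ : ψ.IsHermitian) (htr : ψ.trace = 1) (hp : ψ * ψ = ψ) :
    ∃ u : n → ℂ, ψ = Matrix.vecMulVec u (star u) := by
  have hp' : ψ * ψ = ((1 : ℝ) : ℂ) • ψ := by simpa using hp
  have h1 := hψ.re_trace_of_mul_self hp'
  rw [htr, Complex.one_re, one_mul, hψ.rank_eq_card_non_zero_eigs] at h1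
  obtain ⟨⟨i, hi⟩, huniq⟩ := Fintype.card_eq_one_iff.mp (Nat.cast_eq_one.mp h1.symm)
  set W : Matrix n n ℂ := hψ.eigenvectorUnitary.1 with hW
  have h2 : ψ = W * Matrix.diagonal (fun j => (hψ.eigenvalues j : ℂ)) * Wᴴ := by
    conv_lhs => rw [hψ.spectral_theorem, Unitary.conjStarAlgAut_apply]
    rfl
  refine ⟨fun a => W a i, ?_⟩
  ext a b
  conv_lhs => rw [h2, Matrix.mul_apply, Finset.sum_eq_single_of_mem i (Finset.mem_univ i) (by
    intro j _ hj
    have hj0 : hψ.eigenvalues j = 0 := by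
      by_contra h
      exact hj (congrArg Subtype.val (huniq ⟨j, h⟩))
    rw [Matrix.mul_diagonal, hj0, Complex.ofReal_zero, mul_zero, zero_mul])]
  rw [Matrix.mul_diagonal, (hψ.eigenvalues_cases hp' i).resolve_left hi]
  simp [Matrix.vecMulVec_apply]

theorem AddChar.diagonal_mem_pauliSet {d m : ℕ} [NeZero d] (θ : AddChar (Fin m → Fin d) ℂ) :
    Matrix.diagonal (fun f => θ f) ∈ PauliSet d m := by
  have hω := Complex.isPrimitiveRoot_exp d (NeZero.ne d)
  have hval : ∀ x : Fin d, x = (x : ℕ) • (1 : Fin d) := by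
    intro x
    have hn : ∀ n : ℕ, ((n • (1 : Fin d) : Fin d) : ℕ) = n % d := by
      intro n
      induction n with
      | zero => simp
      | succ n ih => rw [succ_nsmul, Fin.val_add, ih, Fin.val_one', Nat.add_mod_mod,
          Nat.mod_add_mod]
    exact Fin.ext (by rw [hn, Nat.mod_eq_of_lt x.2])
  have hpow : ∀ j (x : Fin d), θ (Pi.single j x) = θ (Pi.single j 1) ^ (x : ℕ) := by
    intro j x
    rw [← AddChar.map_nsmul_eq_pow, ← Pi.single_smul, ← hval]
  have hroot : ∀ j, θ (Pi.single j 1) ^ d = 1 := by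
    intro j
    rw [← AddChar.map_nsmul_eq_pow, ← Pi.single_smul]
    have : d • (1 : Fin d) = 0 := by
      simpa only [Fintype.card_fin] using card_nsmul_eq_zero (x := (1 : Fin d))
    rw [this, Pi.single_zero, AddChar.map_zero_eq_one]
  choose b _ hb using fun j => hω.eq_pow_of_pow_eq_one (hroot j)
  refine ⟨0, 0, b, ?_⟩
  rw [pow_zero, one_smul]
  ext f g
  simp only [Pi.zero_apply, pow_zero, one_mul, clockZ_pow, hb, tensorPow, Matrix.of_apply,
    Matrix.diagonal_apply, Finset.prod_ite_zero, Finset.mem_univ, true_imp_iff]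
  simp only [← funext_iff (f := f)]
  split_ifs with h
  · conv_lhs => rw [← Finset.univ_sum_single f]
    refine (congrArg Additive.toMul (map_sum θ.toAddMonoidHom _ _)).trans ?_
    rw [toMul_sum]
    exact Finset.prod_congr rfl fun j _ => hpow j _
  · rfl

theorem AddChar.diagonal_mem_pauliProd {d k l : ℕ} [NeZero d]
    (θ : AddChar ((Fin k → Fin d) × (Fin l → Fin d)) ℂ) :
    Matrix.diagonal (fun v => θ v) ∈ PauliProd d k l := by
  refine ⟨_, (θ.compAddMonoidHom (AddMonoidHom.inl _ _)).diagonal_mem_pauliSet, _,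
    (θ.compAddMonoidHom (AddMonoidHom.inr _ _)).diagonal_mem_pauliSet, ?_⟩
  rw [Matrix.diagonal_kronecker_diagonal]
  congr 1
  funext ⟨f, g⟩
  simp [← AddChar.map_add_eq_mul]

open Classical in
/-- The maximally mixed state on the span of the computational basis vectors in a subgroup
is a stabilizer state. -/
theorem diagonal_indicator_mem_stab0 {d k l : ℕ} [NeZero d]
    (C : AddSubgroup ((Fin k → Fin d) × (Fin l → Fin d))) :
    ((Nat.card C : ℝ)⁻¹ : ℂ) • Matrix.diagonal (fun v => if v ∈ C then (1 : ℂ) else 0) ∈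
      Stab0 (PauliProd d k l) (d ^ (k + l)) := by
  set V := (Fin k → Fin d) × (Fin l → Fin d)
  have := Fintype.ofFinite (V ⧸ C)
  let D : AddChar (V ⧸ C) ℂ → Matrix V V ℂ := fun χ => Matrix.diagonal fun v => χ (v : V ⧸ C)
  have hDmul : ∀ χ χ', D χ * D χ' = D (χ * χ') := by
    intro χ χ'
    simp [D, Matrix.diagonal_mul_diagonal]
  have hDone : D 1 = 1 := by simp [D]
  have hDinj : Function.Injective D := by
    intro χ χ' h
    ext x
    obtain ⟨v, rfl⟩ := QuotientAddGroup.mk_surjective x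
    exact congrFun (Matrix.diagonal_injective h) v
  refine ⟨Finset.univ.image D, ?_, ?_, ?_, ?_, ?_, ?_, ?_⟩
  · intro P hP
    obtain ⟨χ, -, rfl⟩ := Finset.mem_image.mp (Finset.mem_coe.mp hP)
    exact (χ.compAddMonoidHom (QuotientAddGroup.mk' C)).diagonal_mem_pauliProd
  · exact Finset.mem_image.mpr ⟨1, Finset.mem_univ _, hDone⟩
  · intro P hP Q hQ
    obtain ⟨χ, -, rfl⟩ := Finset.mem_image.mp hP
    obtain ⟨χ', -, rfl⟩ := Finset.mem_image.mp hQ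
    exact Finset.mem_image.mpr ⟨χ * χ', Finset.mem_univ _, (hDmul _ _).symm⟩
  · intro P hP
    obtain ⟨χ, -, rfl⟩ := Finset.mem_image.mp hP
    exact ⟨D χ⁻¹, Finset.mem_image.mpr ⟨_, Finset.mem_univ _, rfl⟩, by
      rw [hDmul, mul_inv_cancel, hDone]⟩
  · intro P hP Q hQ
    obtain ⟨χ, -, rfl⟩ := Finset.mem_image.mp hP
    obtain ⟨χ', -, rfl⟩ := Finset.mem_image.mp hQ
    rw [hDmul, hDmul, mul_comm]
  · rw [Finset.sum_image hDinj.injOn]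
    have hcard : d ^ (k + l) = Fintype.card (V ⧸ C) * Nat.card C := by
      have h1 := AddSubgroup.card_eq_card_quotient_mul_card_addSubgroup C
      rw [Nat.card_eq_fintype_card, Nat.card_eq_fintype_card (α := V ⧸ C)] at h1
      rw [← h1]
      simp [pow_add]
    have hq : (Fintype.card (V ⧸ C) : ℂ) ≠ 0 := Nat.cast_ne_zero.mpr Fintype.card_ne_zero
    ext v w
    simp only [Matrix.smul_apply, Matrix.sum_apply, D, Matrix.diagonal_apply]
    by_cases hvw : v = w
    · simp only [hvw, if_true, AddChar.sum_apply_eq_ite, QuotientAddGroup.eq_zero_iff, hcard]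
      by_cases hw : w ∈ C
      · simp only [hw, if_true, smul_eq_mul]
        push_cast
        field_simp
      · simp [hw]
    · simp [hvw]
  · refine (Matrix.PosSemidef.diagonal fun v => ?_).smul ?_
    · simp only [Pi.zero_apply]
      split_ifs <;> simp
    · rw [← Complex.ofReal_inv]
      exact_mod_cast inv_nonneg.mpr (Nat.cast_nonneg _)

/-- The inclusion of words of length `m` into words of length `k`, padding by zeros. -/
def zeroPad (d m k : ℕ) [NeZero d] : (Fin m → Fin d) →+ (Fin k → Fin d) where
  toFun x j := if h : (j : ℕ) < m then x ⟨j, h⟩ else 0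
  map_zero' := by
    funext j
    simp
  map_add' x y := by
    funext j
    by_cases h : (j : ℕ) < m <;> simp [h]

theorem zeroPad_injective {d m k : ℕ} [NeZero d] (hmk : m ≤ k) :
    Function.Injective (zeroPad d m k) := by
  intro x y h
  funext j
  simpa [zeroPad] using congrFun h ⟨j, j.2.trans_le hmk⟩

/-- Local unitaries carry the Schmidt vectors of a bipartite vector to prescribed distinct
coordinate vectors. -/
theorem exists_local_unitary_mulVec_apply_eq_zero {α β : Type*} [Fintype α] [DecidableEq α]
    [Fintype β] [DecidableEq β] (u : α × β → ℂ) :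
    ∃ S : Finset α, S.card = (ptraceB (Matrix.vecMulVec u (star u))).rank ∧
      S.card ≤ Fintype.card β ∧
      ∀ {iA : S → α} {iB : S → β}, Function.Injective iA → Function.Injective iB →
        ∃ UA ∈ Matrix.unitaryGroup α ℂ, ∃ UB ∈ Matrix.unitaryGroup β ℂ,
          ∀ x, (∀ s, x ≠ (iA s, iB s)) → ((UA ⊗ₖ UB) *ᵥ u) x = 0 := by
  set M : Matrix α β ℂ := Matrix.of fun a b => u (a, b) with hM
  obtain ⟨S, E, D, F, hS, hE, hF, hMS⟩ := M.exists_compact_svd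
  have hpt : ptraceB (Matrix.vecMulVec u (star u)) = M * Mᴴ := by
    ext a a'
    simp [ptraceB, Matrix.mul_apply, Matrix.vecMulVec_apply, hM]
  refine ⟨S, by rw [hS, hpt], ?_, fun {iA iB} hA hB => ?_⟩
  · rw [hS, Matrix.rank_self_mul_conjTranspose]
    exact M.rank_le_card_width
  have hF' : (Fᵀ)ᴴ * Fᵀ = 1 := by
    change (Fᴴ)ᵀ * Fᵀ = 1
    rw [← Matrix.transpose_mul, hF, Matrix.transpose_one]
  obtain ⟨UA, hUA, hEA⟩ := Matrix.exists_unitary_mul_eq_submatrix hE hA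
  obtain ⟨UB, hUB, hFB⟩ := Matrix.exists_unitary_mul_eq_submatrix hF' hB
  refine ⟨UA, hUA, UB, hUB, ?_⟩
  rintro ⟨a, b⟩ hx
  have hu : u = Matrix.vec Mᵀ := rfl
  have hprod : UB * Mᵀ * UAᵀ = (UB * Fᵀ) * Matrix.diagonal D * (UA * E)ᵀ := by
    rw [hMS, Matrix.transpose_mul, Matrix.transpose_mul, Matrix.transpose_mul,
      Matrix.diagonal_transpose]
    simp only [Matrix.mul_assoc]
  rw [hu, Matrix.kronecker_mulVec_vec, hprod, hEA, hFB, Matrix.vec, Matrix.mul_apply]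
  refine Finset.sum_eq_zero fun s _ => ?_
  rw [Matrix.mul_diagonal, Matrix.transpose_apply, Matrix.submatrix_apply,
    Matrix.submatrix_apply, id, id, Matrix.one_apply, Matrix.one_apply]
  by_cases ha : a = iA s
  · rw [if_neg fun hb => hx s (Prod.ext ha hb), zero_mul, zero_mul]
  · rw [if_neg ha, mul_zero]

theorem Matrix.trace_unitary_conj {n : Type*} [Fintype n] [DecidableEq n] (A : Matrix n n ℂ)
    {U : Matrix n n ℂ} (hU : U ∈ Matrix.unitaryGroup n ℂ) : (U * A * Uᴴ).trace = A.trace := by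
  rw [Matrix.trace_mul_cycle, ← Matrix.star_eq_conjTranspose, Matrix.mem_unitaryGroup_iff'.mp hU,
    Matrix.one_mul]

theorem Matrix.rank_unitary_conj {n : Type*} [Fintype n] [DecidableEq n] (A : Matrix n n ℂ)
    {U : Matrix n n ℂ} (hU : U ∈ Matrix.unitaryGroup n ℂ) : (U * A * Uᴴ).rank = A.rank := by
  have h : Uᴴ * U = 1 := Matrix.mem_unitaryGroup_iff'.mp hU
  rw [Matrix.rank_mul_eq_left_of_isUnit_det _ _ (Matrix.isUnit_det_of_right_inverse h),
    Matrix.rank_mul_eq_right_of_isUnit_det _ _ (Matrix.isUnit_det_of_left_inverse h)]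

theorem Matrix.mul_self_unitary_conj {n : Type*} [Fintype n] [DecidableEq n] {A U : Matrix n n ℂ}
    (hA : A * A = A) (hU : U ∈ Matrix.unitaryGroup n ℂ) :
    U * A * Uᴴ * (U * A * Uᴴ) = U * A * Uᴴ := by
  have h : Uᴴ * U = 1 := Matrix.mem_unitaryGroup_iff'.mp hU
  calc U * A * Uᴴ * (U * A * Uᴴ) = U * (A * (Uᴴ * U) * A) * Uᴴ := by
        simp only [Matrix.mul_assoc]
    _ = U * A * Uᴴ := by rw [h, Matrix.mul_one, hA]

/-- The relative entropy from a pure state supported on the computational basis vectors in a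
subgroup to the maximally mixed state on their span. -/
theorem exists_stab0_qRelEntropy_eq_log_card {d k l : ℕ} [NeZero d]
    (C : AddSubgroup ((Fin k → Fin d) × (Fin l → Fin d)))
    {u : (Fin k → Fin d) × (Fin l → Fin d) → ℂ}
    (htr : (Matrix.vecMulVec u (star u)).trace = 1)
    (hp : Matrix.vecMulVec u (star u) * Matrix.vecMulVec u (star u) =
      Matrix.vecMulVec u (star u)) (hu : ∀ x ∉ C, u x = 0) :
    ∃ σ ∈ Stab0 (PauliProd d k l) (d ^ (k + l)),
      qRelEntropy (Matrix.vecMulVec u (star u)) σ = ((Real.log (Nat.card C) : ℝ) : EReal) := by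
  classical
  have hC : (Nat.card C : ℝ) ≠ 0 := Nat.cast_ne_zero.mpr Nat.card_pos.ne'
  have hH := (Matrix.posSemidef_vecMulVec_self_star u).1
  have hσ := diagonal_indicator_mem_stab0 C
  refine ⟨_, hσ, ?_⟩
  obtain ⟨_, _, _, _, _, _, _, hpos⟩ := id hσ
  rw [qRelEntropy_of_mul_self (c := (Nat.card C : ℝ)⁻¹) hH htr hpos.1 (inv_ne_zero hC),
    vnEntropy_of_mul_self hH hp, Real.log_inv, neg_zero, zero_sub, neg_neg]
  · rw [smul_mul_smul_comm, Matrix.diagonal_mul_diagonal, mul_smul, Complex.ofReal_inv]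
    simp
  · intro v hv
    have hv' : ∀ x ∈ C, v x = 0 := by
      intro x hx
      have h := congrFun hv x
      rw [Matrix.smul_mulVec, Pi.smul_apply, Matrix.mulVec_diagonal, if_pos hx, one_mul,
        smul_eq_mul, Pi.zero_apply] at h
      refine (mul_eq_zero.mp h).resolve_left ?_
      rw [← Complex.ofReal_inv]
      exact_mod_cast inv_ne_zero hC
    have h0 : star u ⬝ᵥ v = 0 := by
      refine Finset.sum_eq_zero fun x _ => ?_
      by_cases hx : x ∈ C
      · rw [hv' x hx, mul_zero]
      · rw [Pi.star_apply, hu x hx, star_zero, zero_mul]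
    rw [Matrix.vecMulVec_mulVec, h0, MulOpposite.op_zero, zero_smul]

theorem exists_local_unitary_qRelEntropy_eq {d k l : ℕ} (hd : 2 ≤ d)
    {ψ : Matrix ((Fin k → Fin d) × (Fin l → Fin d)) ((Fin k → Fin d) × (Fin l → Fin d)) ℂ}
    (hψ : ψ.IsHermitian) (hψtr : ψ.trace = 1) (hψp : ψ * ψ = ψ) :
    ∃ UA ∈ Matrix.unitaryGroup (Fin k → Fin d) ℂ, ∃ UB ∈ Matrix.unitaryGroup (Fin l → Fin d) ℂ,
      ∃ σ ∈ Stab0 (PauliProd d k l) (d ^ (k + l)),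
        qRelEntropy ((UA ⊗ₖ UB) * ψ * (UA ⊗ₖ UB)ᴴ) σ =
          ((Real.log d * (⌈Real.log (ptraceB ψ).rank / Real.log d⌉ : ℝ) : ℝ) : EReal) := by
  have : NeZero d := ⟨by omega⟩
  obtain ⟨u, rfl⟩ := exists_eq_vecMulVec_of_pure hψ hψtr hψp
  obtain ⟨S, hS, hSl, hloc⟩ := exists_local_unitary_mulVec_apply_eq_zero u
  set r := (ptraceB (Matrix.vecMulVec u (star u))).rank with hr
  have hd0 : (0 : ℝ) < d := by exact_mod_cast (by omega : 0 < d)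
  have hlog : 0 < Real.log d := Real.log_pos (by exact_mod_cast hd)
  set m := ⌈Real.log r / Real.log d⌉₊ with hm
  have hmle : ∀ t : ℕ, r ≤ d ^ t → m ≤ t := by
    intro t ht
    rw [hm, Nat.ceil_le, div_le_iff₀ hlog]
    rcases Nat.eq_zero_or_pos r with h0 | h0
    · rw [h0, Nat.cast_zero, Real.log_zero]
      positivity
    · rw [← Real.le_pow_iff_log_le (by exact_mod_cast h0) hd0]
      exact_mod_cast ht
  have hmk : m ≤ k := hmle k (by rw [← hS]; simpa using S.card_le_univ)
  have hml : m ≤ l := hmle l (by rw [← hS]; simpa using hSl)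
  have hrm : r ≤ d ^ m := by
    rcases Nat.eq_zero_or_pos r with h0 | h0
    · rw [h0]
      exact Nat.zero_le _
    · have : (r : ℝ) ≤ (d : ℝ) ^ m := by
        rw [Real.le_pow_iff_log_le (by exact_mod_cast h0) hd0, ← div_le_iff₀ hlog]
        exact Nat.le_ceil _
      exact_mod_cast this
  obtain ⟨j⟩ : Nonempty (S ↪ (Fin m → Fin d)) :=
    Function.Embedding.nonempty_of_card_le (by simpa [hS] using hrm)
  have hA := zeroPad_injective (d := d) hmk
  have hB := zeroPad_injective (d := d) hml
  obtain ⟨UA, hUA, UB, hUB, h0⟩ := hloc (hA.comp j.injective) (hB.comp j.injective)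
  have hU : UA ⊗ₖ UB ∈ Matrix.unitaryGroup _ ℂ := Matrix.kronecker_mem_unitary hUA hUB
  set f := (zeroPad d m k).prod (zeroPad d m l) with hf
  have hfinj : Function.Injective f := fun x y h => hA (congrArg Prod.fst h)
  have hcard : Nat.card f.range = d ^ m := by
    rw [← Nat.card_congr (AddMonoidHom.ofInjective hfinj).toEquiv]
    simp
  have hconj : (UA ⊗ₖ UB) * Matrix.vecMulVec u (star u) * (UA ⊗ₖ UB)ᴴ =
      Matrix.vecMulVec ((UA ⊗ₖ UB) *ᵥ u) (star ((UA ⊗ₖ UB) *ᵥ u)) := by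
    rw [Matrix.mul_vecMulVec, Matrix.vecMulVec_mul, Matrix.star_mulVec]
  have htr := (Matrix.trace_unitary_conj _ hU).trans hψtr
  have hp := Matrix.mul_self_unitary_conj hψp hU
  rw [hconj] at htr hp
  obtain ⟨σ, hσ, hval⟩ := exists_stab0_qRelEntropy_eq_log_card f.range htr hp fun x hx =>
    h0 x fun s hs => hx ⟨j s, hs.symm⟩
  refine ⟨UA, hUA, UB, hUB, σ, hσ, ?_⟩
  rw [hconj, hval, hcard, Nat.cast_pow, Real.log_pow, mul_comm, hm,
    natCast_ceil_eq_intCast_ceil (div_nonneg (Real.log_natCast_nonneg _) hlog.le)]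

/-- For a pure state `ψ_AB` of `n ≥ 2` qudits of dimension `d ≥ 2`,
bipartitioned into the first `k` and the last `n−k` qudits (`1 ≤ k < n`), with
`ψ_A = Tr_B ψ_AB`, `S(A) = −Tr[ψ_A log ψ_A]` and `S_max(A) = log rank(ψ_A)`:
`S_max(A) − S(A) ≤ inf_{U_A} M_RS(U_A ψ_A U_Aᴴ) ≤ M_RS^{(NL)}(ψ_AB)
≤ (log d)·⌈S_max(A)/log d⌉`. -/
theorem Mrs_chain_bounds {n d k : ℕ} (hn : 2 ≤ n) (hd : 2 ≤ d) (hk1 : 1 ≤ k) (hkn : k < n)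
    (ψ : Matrix ((Fin k → Fin d) × (Fin (n - k) → Fin d))
      ((Fin k → Fin d) × (Fin (n - k) → Fin d)) ℂ)
    (hψ : ψ.PosSemidef) (hψtr : ψ.trace = 1) (hψpure : ψ * ψ = ψ) :
    ((Real.log ((ptraceB ψ).rank : ℝ) - vnEntropy (ptraceB ψ) : ℝ) : EReal) ≤
        MrsLocalA d k (ptraceB ψ) ∧
      MrsLocalA d k (ptraceB ψ) ≤ MrsNL d n k ψ ∧
      MrsNL d n k ψ ≤
        ((Real.log d *
          (Int.ceil (Real.log ((ptraceB ψ).rank : ℝ) / Real.log d) : ℝ) : ℝ) : EReal) := by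
  have hd0 : d ≠ 0 := by omega
  have hn' : d ^ n = d ^ (k + (n - k)) := by rw [Nat.add_sub_cancel' hkn.le]
  have hρ := hψ.ptraceB
  have hρtr : (ptraceB ψ).trace = 1 := by rw [trace_ptraceB, hψtr]
  refine ⟨?_, ?_, ?_⟩
  · refine le_sInf ?_
    rintro _ ⟨U, hU, rfl⟩
    refine le_sInf ?_
    rintro _ ⟨σ, hσ, rfl⟩
    rw [← vnEntropy_unitary_conj hρ.1 hU, ← Matrix.rank_unitary_conj _ hU]
    exact log_rank_sub_vnEntropy_le_qRelEntropy hd0 (hρ.mul_mul_conjTranspose_same U)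
      ((Matrix.trace_unitary_conj _ hU).trans hρtr) hσ
  · refine le_sInf ?_
    rintro _ ⟨UA, hUA, UB, hUB, rfl⟩
    have hU : UA ⊗ₖ UB ∈ Matrix.unitaryGroup _ ℂ := Matrix.kronecker_mem_unitary hUA hUB
    refine sInf_le_of_le ⟨UA, hUA, rfl⟩ (le_sInf ?_)
    rintro _ ⟨σ, hσ, rfl⟩
    rw [hn'] at hσ
    refine sInf_le_of_le ⟨_, Stab0.ptraceB_mem hd0 hσ, rfl⟩ ?_
    rw [← ptraceB_local_unitary ψ UA hUB]
    exact qRelEntropy_ptraceB_le hd0 (hψ.mul_mul_conjTranspose_same _)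
      ((Matrix.trace_unitary_conj _ hU).trans hψtr)
      (Matrix.mul_self_unitary_conj hψpure hU) hσ
  · obtain ⟨UA, hUA, UB, hUB, σ, hσ, h⟩ := exists_local_unitary_qRelEntropy_eq hd hψ.1 hψtr hψpure
    rw [← hn'] at hσ
    rw [← h]
    exact sInf_le_of_le ⟨UA, hUA, UB, hUB, rfl⟩ (sInf_le ⟨σ, hσ, rfl⟩)
end
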